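/- Let τ₊, τ₋ be the R₁-algebra automorphisms of H^{A₁} determined by τ₊: X ↦ X, T ↦ T, Y ↦ q^{−1/4}·X·Y and τ₋: Y ↦ Y, T ↦ T, X ↦ q^{1/4}·Y·X. Then τ₊ ∘ τ₋⁻¹ ∘ τ₊ = τ₋⁻¹ ∘ τ₊ ∘ τ₋⁻¹, and the common value σ satisfies σ(X) = Y⁻¹, σ(T) = T, σ(Y) = X·T², and σ(Y·T⁻¹) = X·T. -/

import Mathlib

noncomputable section

/-- The base ring `R₁ = ℤ[q^{±1/4}, t^{±1/2}]`: the group algebra of `ℤ × ℤ` over `ℤ`,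
where `q^{1/4}` corresponds to the exponent `(1,0)` and `t^{1/2}` to `(0,1)`. -/
abbrev R1 : Type := AddMonoidAlgebra ℤ (ℤ × ℤ)

/-- `q^{1/4}` -/
def R1.q4 : R1 := AddMonoidAlgebra.single (1, 0) 1
/-- `q^{-1/4}` -/
def R1.q4i : R1 := AddMonoidAlgebra.single (-1, 0) 1
/-- `t^{1/2}` -/
def R1.t2 : R1 := AddMonoidAlgebra.single (0, 1) 1
/-- `t^{-1/2}` -/
def R1.t2i : R1 := AddMonoidAlgebra.single (0, -1) 1
/-- `q^{1/2}` -/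
def R1.q2 : R1 := AddMonoidAlgebra.single (2, 0) 1
/-- `q^{-1/2}` -/
def R1.q2i : R1 := AddMonoidAlgebra.single (-2, 0) 1

/-- Generators of the DAHA of type `A₁`: `T, T⁻¹, X, X⁻¹, Y, Y⁻¹`. -/
inductive A1gen : Type
  | t | ti | x | xi | y | yi

open FreeAlgebra in
/-- The defining relations of the DAHA of type `A₁`. -/
inductive A1rel : FreeAlgebra R1 A1gen → FreeAlgebra R1 A1gen → Prop
  | tti : A1rel (ι R1 A1gen.t * ι R1 A1gen.ti) 1
  | tit : A1rel (ι R1 A1gen.ti * ι R1 A1gen.t) 1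
  | xxi : A1rel (ι R1 A1gen.x * ι R1 A1gen.xi) 1
  | xix : A1rel (ι R1 A1gen.xi * ι R1 A1gen.x) 1
  | yyi : A1rel (ι R1 A1gen.y * ι R1 A1gen.yi) 1
  | yiy : A1rel (ι R1 A1gen.yi * ι R1 A1gen.y) 1
  | hecke : A1rel ((ι R1 A1gen.t - algebraMap R1 _ R1.t2) *
      (ι R1 A1gen.t + algebraMap R1 _ R1.t2i)) 0
  | txt : A1rel (ι R1 A1gen.t * ι R1 A1gen.x * ι R1 A1gen.t) (ι R1 A1gen.xi)
  | tiyti : A1rel (ι R1 A1gen.ti * ι R1 A1gen.y * ι R1 A1gen.ti) (ι R1 A1gen.yi)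
  | cross : A1rel (ι R1 A1gen.yi * ι R1 A1gen.xi * ι R1 A1gen.y * ι R1 A1gen.x *
      ι R1 A1gen.t * ι R1 A1gen.t * algebraMap R1 _ R1.q2) 1

/-- The DAHA of type `A₁`. -/
abbrev HA1 : Type := RingQuot A1rel

namespace HA1

def T : HA1 := RingQuot.mkAlgHom R1 A1rel (FreeAlgebra.ι R1 A1gen.t)
def Ti : HA1 := RingQuot.mkAlgHom R1 A1rel (FreeAlgebra.ι R1 A1gen.ti)
def X : HA1 := RingQuot.mkAlgHom R1 A1rel (FreeAlgebra.ι R1 A1gen.x)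
def Xi : HA1 := RingQuot.mkAlgHom R1 A1rel (FreeAlgebra.ι R1 A1gen.xi)
def Y : HA1 := RingQuot.mkAlgHom R1 A1rel (FreeAlgebra.ι R1 A1gen.y)
def Yi : HA1 := RingQuot.mkAlgHom R1 A1rel (FreeAlgebra.ι R1 A1gen.yi)

/-- image of a base-ring element in `H^{A₁}` -/
def c (r : R1) : HA1 := algebraMap R1 HA1 r

end HA1

open HA1

namespace HA1

lemma T_mul_Ti : T * Ti = 1 := by
  simpa [T, Ti] using RingQuot.mkAlgHom_rel R1 A1rel.tti

lemma Ti_mul_T : Ti * T = 1 := by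
  simpa [T, Ti] using RingQuot.mkAlgHom_rel R1 A1rel.tit

lemma X_mul_Xi : X * Xi = 1 := by
  simpa [X, Xi] using RingQuot.mkAlgHom_rel R1 A1rel.xxi

lemma Xi_mul_X : Xi * X = 1 := by
  simpa [X, Xi] using RingQuot.mkAlgHom_rel R1 A1rel.xix

lemma Y_mul_Yi : Y * Yi = 1 := by
  simpa [Y, Yi] using RingQuot.mkAlgHom_rel R1 A1rel.yyi

lemma Yi_mul_Y : Yi * Y = 1 := by
  simpa [Y, Yi] using RingQuot.mkAlgHom_rel R1 A1rel.yiy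

lemma cross_relation : Yi * Xi * Y * X * T * T * algebraMap R1 HA1 R1.q2 = 1 := by
  have h := RingQuot.mkAlgHom_rel R1 A1rel.cross
  rwa [map_mul, AlgHom.commutes, map_one, map_mul, map_mul, map_mul, map_mul, map_mul] at h

lemma q4i_mul_q4 : R1.q4i * R1.q4 = 1 := by
  simp [R1.q4i, R1.q4, AddMonoidAlgebra.single_mul_single, AddMonoidAlgebra.one_def, Prod.zero_eq_mk]

lemma q4i_mul_q4i_mul_q2 : R1.q4i * R1.q4i * R1.q2 = 1 := by
  simp [R1.q4i, R1.q2, AddMonoidAlgebra.single_mul_single, AddMonoidAlgebra.one_def, Prod.zero_eq_mk]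

lemma Yi_mul_X_mul_Y : Yi * X * Y = R1.q2 • (X * T * T) := by
  have h := cross_relation
  rw [← Algebra.commutes, ← Algebra.smul_def] at h
  calc Yi * X * Y = Yi * X * Y * (R1.q2 • (Yi * Xi * Y * X * T * T)) := by rw [h, mul_one]
    _ = R1.q2 • (Yi * (X * (Y * Yi) * Xi) * Y * X * T * T) := by
      simp only [mul_smul_comm, mul_assoc]
    _ = R1.q2 • (X * T * T) := by
      rw [Y_mul_Yi, mul_one, X_mul_Xi, mul_one, Yi_mul_Y, one_mul]

/-- An algebra homomorphism out of `H^{A₁}` is determined by its values on `T`, `X`, `Y`. -/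
lemma algHom_ext {A : Type*} [Semiring A] [Algebra R1 A] {f g : HA1 →ₐ[R1] A}
    (hT : f T = g T) (hX : f X = g X) (hY : f Y = g Y) : f = g := by
  have inv {a b : HA1} (hab : a * b = 1) (hba : b * a = 1) (h : f a = g a) : f b = g b :=
    left_inv_eq_right_inv (a := f a) (by rw [← map_mul, hba, map_one])
      (by rw [h, ← map_mul, hab, map_one])
  apply RingQuot.ringQuot_ext'
  apply FreeAlgebra.hom_ext
  funext i
  cases i
  · exact hT
  · exact inv T_mul_Ti Ti_mul_T hT
  · exact hX
  · exact inv X_mul_Xi Xi_mul_X hX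
  · exact hY
  · exact inv Y_mul_Yi Yi_mul_Y hY

end HA1

/-- for the automorphisms `τ₊, τ₋` of `H^{A₁}` one has
`τ₊ ∘ τ₋⁻¹ ∘ τ₊ = τ₋⁻¹ ∘ τ₊ ∘ τ₋⁻¹`, and the common value `σ` satisfies
`σ(X) = Y⁻¹`, `σ(T) = T`, `σ(Y) = X·T²`, `σ(Y·T⁻¹) = X·T`. -/
theorem statement6 :
    ∀ τp τm : HA1 ≃ₐ[R1] HA1,
      (τp X = X ∧ τp T = T ∧ τp Y = c R1.q4i * X * Y) →
      (τm Y = Y ∧ τm T = T ∧ τm X = c R1.q4 * Y * X) →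
      (∀ h : HA1, τp (τm.symm (τp h)) = τm.symm (τp (τm.symm h))) ∧
      τp (τm.symm (τp X)) = Yi ∧
      τp (τm.symm (τp T)) = T ∧
      τp (τm.symm (τp Y)) = X * T * T ∧
      τp (τm.symm (τp (Y * Ti))) = X * T := by
  rintro τp τm ⟨hpX, hpT, hpY⟩ ⟨hmY, hmT, hmX⟩
  simp only [c, ← Algebra.smul_def, smul_mul_assoc] at hpY hmX
  have hpYi : τp Yi = R1.q4 • (Yi * Xi) := by
    refine left_inv_eq_right_inv (a := τp Y) (by rw [← map_mul, Yi_mul_Y, map_one]) ?_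
    rw [hpY, smul_mul_smul_comm, q4i_mul_q4, one_smul, mul_assoc, ← mul_assoc Y, Y_mul_Yi,
      one_mul, X_mul_Xi]
  have hnY : τm.symm Y = Y := by rw [AlgEquiv.symm_apply_eq, hmY]
  have hnT : τm.symm T = T := by rw [AlgEquiv.symm_apply_eq, hmT]
  have hmYi : τm Yi = Yi :=
    left_inv_eq_right_inv (a := Y) (by nth_rw 1 [← hmY]; rw [← map_mul, Yi_mul_Y, map_one]) Y_mul_Yi
  have hnYi : τm.symm Yi = Yi := by rw [AlgEquiv.symm_apply_eq, hmYi]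
  have hnX : τm.symm X = R1.q4i • (Yi * X) := by
    rw [AlgEquiv.symm_apply_eq, map_smul, map_mul, hmYi, hmX, mul_smul_comm, smul_smul,
      q4i_mul_q4, one_smul, ← mul_assoc, Yi_mul_Y, one_mul]
  have hpnX : τp (τm.symm X) = Yi := by
    rw [hnX, map_smul, map_mul, hpYi, hpX, smul_mul_assoc, smul_smul, q4i_mul_q4, one_smul,
      mul_assoc, Xi_mul_X, mul_one]
  have hconj : R1.q4i • R1.q4i • (Yi * X * Y) = X * T * T := by
    rw [Yi_mul_X_mul_Y, smul_smul, smul_smul, q4i_mul_q4i_mul_q2, one_smul]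
  have hσX : τp (τm.symm (τp X)) = Yi := by rw [hpX, hpnX]
  have hσT : τp (τm.symm (τp T)) = T := by rw [hpT, hnT, hpT]
  have hσY : τp (τm.symm (τp Y)) = X * T * T := by
    rw [hpY, map_smul, map_mul, map_smul, map_mul, hpnX, hnY, hpY, mul_smul_comm, ← mul_assoc,
      hconj]
  have hσTi : τp (τm.symm (τp Ti)) = Ti :=
    left_inv_eq_right_inv (a := T)
      (by
      calc τp (τm.symm (τp Ti)) * T = τp (τm.symm (τp Ti)) * τp (τm.symm (τp T)) := by rw [hσT]
        _ = 1 := by simp only [← map_mul, Ti_mul_T, map_one]) T_mul_Ti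
  refine ⟨fun h => ?_, hσX, hσT, hσY, ?_⟩
  · have key : ((τp.trans τm.symm).trans τp : HA1 →ₐ[R1] HA1) =
        ((τm.symm.trans τp).trans τm.symm : HA1 →ₐ[R1] HA1) := by
      apply algHom_ext
      · change τp (τm.symm (τp T)) = τm.symm (τp (τm.symm T))
        rw [hσT, hnT, hpT, hnT]
      · change τp (τm.symm (τp X)) = τm.symm (τp (τm.symm X))
        rw [hσX, hpnX, hnYi]
      · change τp (τm.symm (τp Y)) = τm.symm (τp (τm.symm Y))
        rw [hσY, hnY, hpY, map_smul, map_mul, hnX, hnY, smul_mul_assoc, hconj]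
    exact DFunLike.congr_fun key h
  · rw [map_mul, map_mul, map_mul, hσY, hσTi, mul_assoc, T_mul_Ti, mul_one]
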